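/- Let f be a multiplicative arithmetic function satisfying 0 ≤ f(p^r) ≤ c₁·c₂^r for all primes p and all r ≥ 1, where c₁ ≥ 1 and 1 ≤ c₂ < 2 are constants, and suppose that ∑_{p ≤ x, p prime} f(p) = τ·Li(x) + O(x·(log x)^{-2-ρ}) for fixed real numbers τ > 0 and ρ > 1, and let B_f be the constant with ∑_{n ≤ x} Λ_f(n)/n = τ·log x + B_f + o(1). Then B_f = −lim_{s→1⁺} ( L_f'(s)/L_f(s) + τ/(s−1) ), where L_f(s) = ∑_{n=1}^∞ f(n)·n^{-s}. -/

import Mathlib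

open Filter Finset Asymptotics Topology

lemma aux_abel (e : ℕ → ℝ) (E : ℝ)
    (h : Tendsto (fun N => ∑ i ∈ range N, e i) atTop (𝓝 E)) :
    ∃ D : ℝ → ℝ, (∀ δ : ℝ, 0 < δ →
      Tendsto (fun N => ∑ i ∈ range N, e i * ((i : ℝ) + 1) ^ (-δ)) atTop (𝓝 (D δ))) ∧
      Tendsto D (𝓝[>] 0) (𝓝 E) := by
  set P : ℕ → ℝ := fun N => ∑ i ∈ range N, e i with hP
  set w : ℝ → ℕ → ℝ := fun δ i => ((i : ℝ) + 1) ^ (-δ) - ((i : ℝ) + 1 + 1) ^ (-δ) with hw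
  have hw0 : ∀ δ : ℝ, 0 < δ → ∀ i, 0 ≤ w δ i := by
    intro δ hδ i
    simp only [hw]
    have := Real.rpow_le_rpow_of_nonpos (x := (i:ℝ) + 1) (y := (i:ℝ) + 1 + 1) (z := -δ)
      (by positivity) (by linarith) (by linarith)
    linarith
  have hv : ∀ δ : ℝ, 0 < δ → Tendsto (fun N : ℕ => ((N : ℝ) + 1) ^ (-δ)) atTop (𝓝 0) := by
    intro δ hδ
    exact (tendsto_rpow_neg_atTop hδ).comp
      (tendsto_atTop_add_const_right _ _ tendsto_natCast_atTop_atTop)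
  have hws : ∀ δ : ℝ, 0 < δ → HasSum (w δ) 1 := by
    intro δ hδ
    rw [hasSum_iff_tendsto_nat_of_nonneg (hw0 δ hδ)]
    have : ∀ N, ∑ i ∈ range N, w δ i = 1 - ((N : ℝ) + 1) ^ (-δ) := by
      intro N
      induction N with
      | zero => simp
      | succ N ih => rw [sum_range_succ, ih]; simp only [hw]; push_cast; ring
    simp_rw [this]
    simpa using (hv δ hδ).const_sub 1
  have hQ : Tendsto (fun n => P (n + 1)) atTop (𝓝 E) := h.comp (tendsto_add_atTop_nat 1)
  obtain ⟨C, hC⟩ : ∃ C : ℝ, ∀ n, |P (n + 1)| ≤ C := by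
    obtain ⟨C, hC⟩ := hQ.abs.bddAbove_range
    exact ⟨C, fun n => hC ⟨n, rfl⟩⟩
  have hsum : ∀ δ : ℝ, 0 < δ → Summable (fun n => P (n + 1) * w δ n) := by
    intro δ hδ
    refine Summable.of_norm_bounded ((hws δ hδ).summable.mul_left C) fun n => ?_
    rw [norm_mul, Real.norm_eq_abs, Real.norm_eq_abs, abs_of_nonneg (hw0 δ hδ n)]
    exact mul_le_mul_of_nonneg_right (hC n) (hw0 δ hδ n)
  refine ⟨fun δ => ∑' n, P (n + 1) * w δ n, fun δ hδ => ?_, ?_⟩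
  · have : ∀ N, ∑ i ∈ range N, e i * ((i : ℝ) + 1) ^ (-δ)
        = P N * ((N : ℝ) + 1) ^ (-δ) + ∑ i ∈ range N, P (i + 1) * w δ i := by
      intro N
      induction N with
      | zero => simp [hP]
      | succ N ih =>
        have h1 : P (N + 1) = P N + e N := by simp [hP, sum_range_succ]
        rw [sum_range_succ, ih, sum_range_succ, h1]
        simp only [hw]; push_cast; ring
    simp_rw [this]
    simpa using (h.mul (hv δ hδ)).add (hsum δ hδ).hasSum.tendsto_sum_nat
  · rw [Metric.tendsto_nhds]
    intro ε hε
    obtain ⟨M, hM⟩ := (Metric.tendsto_atTop.1 hQ) (ε / 2) (by positivity)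
    have hfin : Tendsto (fun δ : ℝ => ∑ n ∈ range M, |P (n + 1) - E| * w δ n) (𝓝[>] 0) (𝓝 0) := by
      have : Tendsto (fun δ : ℝ => ∑ n ∈ range M, |P (n + 1) - E| * w δ n) (𝓝[>] 0)
          (𝓝 (∑ n ∈ range M, |P (n + 1) - E| * 0)) := by
        refine tendsto_finsetSum _ fun n _ => Tendsto.const_mul _ ?_
        have hc : Continuous (fun δ : ℝ => w δ n) := by
          simp only [hw]
          refine Continuous.sub ?_ ?_
          · exact (continuous_const).rpow continuous_neg (fun x => Or.inl (by positivity))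
          · exact (continuous_const).rpow continuous_neg (fun x => Or.inl (by positivity))
        have := hc.tendsto 0
        simp only [hw, neg_zero, Real.rpow_zero, sub_self] at this
        exact this.mono_left nhdsWithin_le_nhds
      simpa using this
    filter_upwards [self_mem_nhdsWithin, hfin.eventually (gt_mem_nhds (half_pos hε))] with δ hδ hlt
    have hδ : 0 < δ := hδ
    rw [Real.dist_eq]
    have h1 : HasSum (fun n => (P (n + 1) - E) * w δ n) ((∑' n, P (n + 1) * w δ n) - E) := by
      have := (hsum δ hδ).hasSum.sub ((hws δ hδ).mul_left E)
      simpa [sub_mul] using this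
    have h2 : HasSum (fun n => (if n ∈ range M then |P (n + 1) - E| * w δ n else 0) + ε / 2 * w δ n)
        (∑ n ∈ range M, |P (n + 1) - E| * w δ n + ε / 2 * 1) := by
      refine HasSum.add ?_ ((hws δ hδ).mul_left _)
      have := hasSum_sum_of_ne_finset_zero (L := SummationFilter.unconditional ℕ) (f := fun n => if n ∈ range M then |P (n + 1) - E| * w δ n else 0)
        (s := range M) (fun b hb => by simp only [hb, if_false])
      rwa [sum_congr rfl (fun n hn => if_pos hn)] at this
    have h3 := h1.norm_le_of_bounded h2 (fun n => by
      rw [norm_mul, Real.norm_eq_abs, Real.norm_eq_abs, abs_of_nonneg (hw0 δ hδ n)]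
      split_ifs with hn
      · have := mul_nonneg (half_pos hε).le (hw0 δ hδ n)
        linarith
      · rw [zero_add]
        have := hM n (by simpa using hn)
        rw [Real.dist_eq] at this
        exact mul_le_mul_of_nonneg_right this.le (hw0 δ hδ n))
    rw [Real.norm_eq_abs] at h3
    linarith

lemma aux_mertens (a b g : ℕ → ℝ) (β : ℝ) (ha : Summable a) (ha0 : a 0 = 0)
    (hb : Tendsto (fun N => ∑ m ∈ Ioc 0 N, b m) atTop (𝓝 β))
    (hg : ∀ n, 1 ≤ n → g n = ∑ d ∈ n.divisors, a d * b (n / d)) :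
    Tendsto (fun N => ∑ n ∈ Ioc 0 N, g n) atTop (𝓝 ((∑' n, a n) * β)) := by
  let A : ArithmeticFunction ℝ := ⟨a, ha0⟩
  let B : ArithmeticFunction ℝ := ⟨fun n => if n = 0 then 0 else b n, by simp⟩
  set S : ℕ → ℝ := fun N => ∑ m ∈ Ioc 0 N, b m with hS
  have h1 : ∀ N, ∑ n ∈ Ioc 0 N, g n = ∑' d, a d * S (N / d) := by
    intro N
    have e1 : ∑ n ∈ Ioc 0 N, g n = ∑ n ∈ Ioc 0 N, (A * B) n := by
      refine sum_congr rfl fun n hn => ?_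
      have hn := mem_Ioc.1 hn
      rw [hg n hn.1, ArithmeticFunction.mul_apply, ← Nat.map_div_right_divisors, sum_map]
      refine sum_congr rfl fun d hd => ?_
      have hd := Nat.mem_divisors.1 hd
      have : n / d ≠ 0 := (Nat.div_pos (Nat.le_of_dvd hn.1 hd.1) (Nat.pos_of_dvd_of_pos hd.1 hn.1)).ne'
      change a d * b (n / d) = a d * (if n / d = 0 then 0 else b (n / d))
      rw [if_neg this]
    rw [e1, ArithmeticFunction.sum_Ioc_mul_eq_sum_sum, tsum_eq_sum (s := Ioc 0 N)]
    · refine sum_congr rfl fun n hn => ?_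
      have : ∑ m ∈ Ioc 0 (N / n), B m = S (N / n) := by
        refine sum_congr rfl fun m hm => ?_
        have := (mem_Ioc.1 hm).1.ne'
        simp [B, this]
      rw [this]; rfl
    · intro d hd
      rcases Nat.eq_zero_or_pos d with rfl | hd0
      · simp [ha0]
      · have : N < d := by
          by_contra hh
          exact hd (mem_Ioc.2 ⟨hd0, by omega⟩)
        simp [Nat.div_eq_of_lt this, hS]
  simp_rw [h1]
  obtain ⟨C, hC⟩ : ∃ C : ℝ, ∀ n, |S n| ≤ C := by
    obtain ⟨C, hC⟩ := hb.abs.bddAbove_range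
    exact ⟨C, fun n => hC ⟨n, rfl⟩⟩
  rw [← tsum_mul_right]
  refine tendsto_tsum_of_dominated_convergence (bound := fun d => |a d| * C) (ha.abs.mul_right C) ?_ ?_
  · intro d
    rcases Nat.eq_zero_or_pos d with rfl | hd0
    · simp [ha0]
    · exact (hb.comp (Nat.tendsto_div_const_atTop hd0.ne')).const_mul _
  · filter_upwards with N d
    rw [norm_mul, Real.norm_eq_abs, Real.norm_eq_abs]
    exact mul_le_mul_of_nonneg_left (hC _) (abs_nonneg _)

lemma aux_nonneg (f : ℕ → ℝ) (hf1 : f 1 = 1)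
    (hfmult : ∀ m n : ℕ, Nat.Coprime m n → f (m * n) = f m * f n)
    (h : ∀ p r : ℕ, p.Prime → 1 ≤ r → 0 ≤ f (p ^ r)) (n : ℕ) (hn : 1 ≤ n) : 0 ≤ f n := by
  induction n using Nat.recOnPosPrimePosCoprime with
  | zero => omega
  | one => simp [hf1]
  | prime_pow p k hp hk => exact h p k hp hk
  | coprime a b ha hb hab ha' hb' =>
    rw [hfmult a b hab]
    exact mul_nonneg (ha' (by omega)) (hb' (by omega))

lemma aux_summable (f : ℕ → ℝ) (c₁ c₂ : ℝ) (hf1 : f 1 = 1)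
    (hfmult : ∀ m n : ℕ, Nat.Coprime m n → f (m * n) = f m * f n)
    (hc₁ : 1 ≤ c₁) (hc₂ : 1 ≤ c₂) (hc₂' : c₂ < 2)
    (hbound : ∀ p r : ℕ, p.Prime → 1 ≤ r → 0 ≤ f (p ^ r) ∧ f (p ^ r) ≤ c₁ * c₂ ^ r)
    (s : ℝ) (hs : 1 < s) : Summable (fun n : ℕ => f n * (n : ℝ) ^ (-s)) := by
  set g : ℕ → ℝ := fun n : ℕ => f n * (n : ℝ) ^ (-s) with hg
  have hg0 : ∀ n, 0 ≤ g n := by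
    intro n
    rcases Nat.eq_zero_or_pos n with rfl | hn
    · simp [hg, Real.zero_rpow (by linarith : -s ≠ 0)]
    · exact mul_nonneg (aux_nonneg f hf1 hfmult (fun p r hp hr => (hbound p r hp hr).1) n hn)
        (by positivity)
  have hg1 : g 1 = 1 := by simp [hg, hf1]
  have hgm : ∀ {m n : ℕ}, Nat.Coprime m n → g (m * n) = g m * g n := by
    intro m n hmn
    simp only [hg]
    rw [hfmult m n hmn, Nat.cast_mul, Real.mul_rpow (by positivity) (by positivity)]
    ring
  -- bounds on prime powers
  have hx : ∀ p : ℕ, p.Prime → c₂ * (p : ℝ) ^ (-s) ≤ c₂ / 2 := by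
    intro p hp
    have h2 : (2 : ℝ) ≤ p := by exact_mod_cast hp.two_le
    have : (p : ℝ) ^ (-s) ≤ 1 / 2 := by
      calc (p : ℝ) ^ (-s) ≤ (p : ℝ) ^ (-1 : ℝ) :=
            Real.rpow_le_rpow_of_exponent_le (by linarith) (by linarith)
        _ = (p : ℝ)⁻¹ := Real.rpow_neg_one _
        _ ≤ 1 / 2 := by rw [inv_le_comm₀ (by linarith) (by norm_num)]; norm_num; exact hp.two_le
    nlinarith
  have hgp : ∀ p r : ℕ, p.Prime → g (p ^ (r + 1)) ≤ c₁ * (c₂ * (p : ℝ) ^ (-s)) ^ (r + 1) := by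
    intro p r hp
    simp only [hg]
    have e : ((p ^ (r + 1) : ℕ) : ℝ) ^ (-s) = ((p : ℝ) ^ (-s)) ^ (r + 1) := by
      rw [Nat.cast_pow, ← Real.rpow_natCast, ← Real.rpow_natCast, ← Real.rpow_mul (by positivity),
        ← Real.rpow_mul (by positivity), mul_comm]
    rw [e, mul_pow, ← mul_assoc]
    exact mul_le_mul_of_nonneg_right (hbound p (r + 1) hp (by omega)).2 (by positivity)
  set K : ℝ := c₁ * c₂ / (1 - c₂ / 2) with hK
  have hK0 : 0 ≤ K := div_nonneg (by positivity) (by linarith)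
  have hps : ∀ p : ℕ, p.Prime → Summable (fun r : ℕ => g (p ^ r)) ∧
      ∑' r : ℕ, g (p ^ r) ≤ 1 + K * (p : ℝ) ^ (-s) := by
    intro p hp
    set x := c₂ * (p : ℝ) ^ (-s) with hxdef
    have hx0 : 0 ≤ x := by positivity
    have hx1 : x < 1 := by have := hx p hp; linarith
    have hgeo : HasSum (fun r : ℕ => c₁ * x ^ (r + 1)) (c₁ * x * (1 - x)⁻¹) := by
      have := (hasSum_geometric_of_lt_one hx0 hx1).mul_left (c₁ * x)
      have e : (fun r : ℕ => c₁ * x ^ (r + 1)) = fun r : ℕ => c₁ * x * x ^ r := by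
        ext r; ring
      rw [e]; exact this
    have hs1 : Summable (fun r : ℕ => g (p ^ (r + 1))) :=
      Summable.of_nonneg_of_le (fun r => hg0 _) (fun r => hgp p r hp) hgeo.summable
    have hs0 : Summable (fun r : ℕ => g (p ^ r)) := (summable_nat_add_iff 1).1 hs1
    refine ⟨hs0, ?_⟩
    rw [hs0.tsum_eq_zero_add, pow_zero, hg1]
    have h1 : ∑' r : ℕ, g (p ^ (r + 1)) ≤ c₁ * x * (1 - x)⁻¹ := by
      rw [← hgeo.tsum_eq]
      exact hs1.tsum_le_tsum (fun r => hgp p r hp) hgeo.summable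
    have h2 : c₁ * x * (1 - x)⁻¹ ≤ c₁ * x * (1 - c₂ / 2)⁻¹ := by
      refine mul_le_mul_of_nonneg_left ?_ (by positivity)
      exact inv_anti₀ (by linarith) (by have := hx p hp; linarith)
    have h3 : c₁ * x * (1 - c₂ / 2)⁻¹ = K * (p : ℝ) ^ (-s) := by
      rw [hK, hxdef]; ring
    linarith
  have hzs : Summable (fun n : ℕ => K * (n : ℝ) ^ (-s)) :=
    (Real.summable_nat_rpow.2 (by linarith)).mul_left K
  refine summable_of_sum_range_le (c := Real.exp (∑' n : ℕ, K * (n : ℝ) ^ (-s))) hg0 fun N => ?_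
  obtain ⟨hS1, hS2⟩ := EulerProduct.summable_and_hasSum_smoothNumbers_prod_primesBelow_tsum hg1 hgm
    (fun {p} hp => (hps p hp).1.norm) N
  have e1 : ∑ i ∈ range N, g i ≤ ∏ p ∈ N.primesBelow, ∑' n : ℕ, g (p ^ n) := by
    have hh : HasSum ((Nat.smoothNumbers N).indicator g) (∏ p ∈ N.primesBelow, ∑' n : ℕ, g (p ^ n)) :=
      (hasSum_subtype_iff_indicator).1 hS2
    refine le_trans (sum_le_sum (g := (Nat.smoothNumbers N).indicator g) ?_)
      (sum_le_hasSum _ (fun i _ => Set.indicator_nonneg (fun n _ => hg0 n) i) hh)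
    intro i hi
    rcases Nat.eq_zero_or_pos i with rfl | hi0
    · have : g 0 = 0 := by simp [hg, Real.zero_rpow (by linarith : -s ≠ 0)]
      rw [this]
      exact Set.indicator_nonneg (fun n _ => hg0 n) 0
    · rw [Set.indicator_of_mem]
      exact Nat.mem_smoothNumbers_of_lt hi0 (mem_range.1 hi)
  refine e1.trans ?_
  calc ∏ p ∈ N.primesBelow, ∑' n : ℕ, g (p ^ n)
      ≤ ∏ p ∈ N.primesBelow, Real.exp (K * (p : ℝ) ^ (-s)) := by
        refine prod_le_prod (fun p _ => tsum_nonneg fun n => hg0 _) fun p hp => ?_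
        have := (hps p (Nat.prime_of_mem_primesBelow hp)).2
        have h2 := Real.add_one_le_exp (K * (p : ℝ) ^ (-s))
        linarith
    _ = Real.exp (∑ p ∈ N.primesBelow, K * (p : ℝ) ^ (-s)) := (Real.exp_sum _ _).symm
    _ ≤ _ := Real.exp_le_exp.2 (hzs.sum_le_tsum _ (fun n _ => by positivity))

/-- derivative of the Dirichlet series -/
lemma aux_deriv (f : ℕ → ℝ)
    (hsum : ∀ s : ℝ, 1 < s → Summable (fun n : ℕ => f n * (n : ℝ) ^ (-s))) (s : ℝ) (hs : 1 < s) :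
    (∀ u : ℝ, 1 < u → ∑' n : ℕ, f (n + 1) / ((n : ℝ) + 1) ^ u = ∑' n : ℕ, f n * (n : ℝ) ^ (-u)) ∧
    HasSum (fun n : ℕ => f n * Real.log n * (n : ℝ) ^ (-s))
      (-deriv (fun u : ℝ => ∑' n : ℕ, f (n + 1) / ((n : ℝ) + 1) ^ u) s) := by
  have h1 : ∀ u : ℝ, 1 < u →
      ∑' n : ℕ, f (n + 1) / ((n : ℝ) + 1) ^ u = ∑' n : ℕ, f n * (n : ℝ) ^ (-u) := by
    intro u hu
    rw [(hsum u hu).tsum_eq_zero_add]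
    simp only [Nat.cast_zero, Real.zero_rpow (by linarith : -u ≠ 0), mul_zero, zero_add]
    refine tsum_congr fun n => ?_
    rw [Real.rpow_neg (by positivity)]
    push_cast
    rfl
  refine ⟨h1, ?_⟩
  let F : ℕ → ℂ := fun n => (f n : ℂ)
  have hterm : ∀ (g : ℕ → ℝ) (u : ℝ), 1 < u → ∀ n, LSeries.term (fun n => (g n : ℂ)) u n
      = ((g n * (n : ℝ) ^ (-u) : ℝ) : ℂ) := by
    intro g u hu n
    rw [LSeries.term_def]
    split_ifs with hn
    · simp [hn, Real.zero_rpow (by linarith : -u ≠ 0)]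
    · rw [Real.rpow_neg (by positivity)]
      push_cast
      rw [Complex.ofReal_cpow (by positivity)]
      push_cast
      rfl
  have hab : LSeries.abscissaOfAbsConv F < ((s : ℂ).re : EReal) := by
    refine lt_of_le_of_lt (LSeries.abscissaOfAbsConv_le_of_forall_lt_LSeriesSummable (x := 1) ?_)
      (by simpa using (by exact_mod_cast hs))
    intro y hy
    unfold LSeriesSummable
    have := Complex.ofRealCLM.summable (hsum y hy)
    refine this.congr fun n => ?_
    rw [hterm f y hy]; rfl
  have hd := (LSeries_hasDerivAt hab).real_of_complex
  have hev : (fun u : ℝ => ∑' n : ℕ, f (n + 1) / ((n : ℝ) + 1) ^ u) =ᶠ[𝓝 s]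
      fun u : ℝ => (LSeries F u).re := by
    filter_upwards [lt_mem_nhds hs] with u hu
    rw [h1 u hu, LSeries, tsum_congr (hterm f u hu), ← Complex.ofReal_tsum, Complex.ofReal_re]
  rw [(hd.congr_of_eventuallyEq hev).deriv]
  have hls := LSeriesSummable_logMul_of_lt_re hab
  have hl : LSeries.logMul F = fun n => ((f n * Real.log n : ℝ) : ℂ) := by
    ext n
    simp [LSeries.logMul, F, mul_comm]
  have := Complex.hasSum_re hls.hasSum
  simp only [Complex.neg_re, neg_neg]
  have e : (fun n : ℕ => f n * Real.log n * (n : ℝ) ^ (-s))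
      = fun n => (LSeries.term (LSeries.logMul F) (↑s) n).re := by
    ext n
    rw [hl, hterm (fun n => f n * Real.log n) s hs, Complex.ofReal_re]
  rw [e]
  exact this

lemma aux_zeta : Tendsto (fun s : ℝ => (∑' n : ℕ, ((n : ℝ) + 1) ^ (-s)) - 1 / (s - 1)) (𝓝[>] 1)
    (𝓝 Real.eulerMascheroniConstant) := by
  have := (Complex.continuous_re.tendsto _).comp
    ZetaAsymptotics.tendsto_riemannZeta_sub_one_div_nhds_right
  rw [Complex.ofReal_re] at this
  refine this.congr' ?_
  filter_upwards [self_mem_nhdsWithin] with s hs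
  have hs : 1 < s := hs
  simp only [Function.comp]
  rw [zeta_eq_tsum_one_div_nat_add_one_cpow (by simpa using hs)]
  have : ∀ n : ℕ, 1 / ((n : ℂ) + 1) ^ (s : ℂ) = ((((n : ℝ) + 1) ^ (-s) : ℝ) : ℂ) := by
    intro n
    rw [Real.rpow_neg (by positivity)]
    push_cast
    rw [Complex.ofReal_cpow (by positivity)]
    push_cast
    simp
  rw [tsum_congr this, ← Complex.ofReal_tsum]
  rw [Complex.sub_re, Complex.ofReal_re]
  congr 1
  rw [← Complex.ofReal_one, ← Complex.ofReal_sub, ← Complex.ofReal_div, Complex.ofReal_re]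

/-- **Lemma 1.** With `f` as in Moree's theorem and `B_f` the constant with
`∑_{n ≤ x} Λ_f(n)/n = τ log x + B_f + o(1)`, one has
`B_f = -lim_{s→1⁺} (L_f'(s)/L_f(s) + τ/(s-1))`, where `L_f(s) = ∑ f(n) n^{-s}`. -/
theorem moree_B_eq_neg_limit
    (f : ℕ → ℝ) (c₁ c₂ τ ρ B : ℝ)
    (hf1 : f 1 = 1)
    (hfmult : ∀ m n : ℕ, Nat.Coprime m n → f (m * n) = f m * f n)
    (hc₁ : 1 ≤ c₁) (hc₂ : 1 ≤ c₂) (hc₂' : c₂ < 2)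
    (hbound : ∀ p r : ℕ, p.Prime → 1 ≤ r → 0 ≤ f (p ^ r) ∧ f (p ^ r) ≤ c₁ * c₂ ^ r)
    (hτ : 0 < τ) (hρ : 1 < ρ)
    (hprimes : (fun x : ℝ => (∑ p ∈ (Finset.Icc 1 ⌊x⌋₊).filter Nat.Prime, f p)
        - τ * ∫ t in (2:ℝ)..x, 1 / Real.log t) =O[atTop]
        fun x : ℝ => x * Real.log x ^ (-2 - ρ))
    (Λf : ℕ → ℝ)
    (hΛf : ∀ n : ℕ, 1 ≤ n → f n * Real.log n = ∑ d ∈ n.divisors, f d * Λf (n / d))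
    (hB : Tendsto (fun x : ℝ => (∑ n ∈ Finset.Icc 1 ⌊x⌋₊, Λf n / n) - τ * Real.log x)
        atTop (𝓝 B)) :
    Tendsto (fun s : ℝ =>
        deriv (fun u : ℝ => ∑' n : ℕ, f (n + 1) / ((n : ℝ) + 1) ^ u) s
          / (∑' n : ℕ, f (n + 1) / ((n : ℝ) + 1) ^ s) + τ / (s - 1))
      (𝓝[>] (1 : ℝ)) (𝓝 (-B)) := by
  have hsum := aux_summable f c₁ c₂ hf1 hfmult hc₁ hc₂ hc₂' hbound
  have hIcc : ∀ (g : ℕ → ℝ) (N : ℕ), ∑ n ∈ Icc 1 N, g n = ∑ i ∈ range N, g (i + 1) := by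
    intro g N
    induction N with
    | zero => simp
    | succ N ih => rw [sum_range_succ, ← ih, sum_Icc_succ_top (by omega)]
  have hBN : Tendsto (fun N : ℕ => (∑ i ∈ range N, Λf (i + 1) / ((i : ℝ) + 1)) - τ * Real.log N)
      atTop (𝓝 B) := by
    refine (hB.comp tendsto_natCast_atTop_atTop).congr fun N => ?_
    simp only [Function.comp, Nat.floor_natCast]
    rw [hIcc]
    push_cast
    rfl
  have he : Tendsto (fun N : ℕ => ∑ i ∈ range N, (Λf (i + 1) - τ) / ((i : ℝ) + 1))
      atTop (𝓝 (B - τ * Real.eulerMascheroniConstant)) := by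
    refine (hBN.sub (Real.tendsto_harmonic_sub_log.const_mul τ)).congr fun N => ?_
    simp only [sub_div, sum_sub_distrib, harmonic]
    push_cast
    simp only [div_eq_mul_inv, mul_sub, mul_sum]
    ring
  obtain ⟨D, hD1, hD2⟩ := aux_abel _ _ he
  have key : ∀ s : ℝ, 1 < s →
      deriv (fun u : ℝ => ∑' n : ℕ, f (n + 1) / ((n : ℝ) + 1) ^ u) s
        / (∑' n : ℕ, f (n + 1) / ((n : ℝ) + 1) ^ s) + τ / (s - 1)
      = -(D (s - 1) + τ * ((∑' n : ℕ, ((n : ℝ) + 1) ^ (-s)) - 1 / (s - 1))) := by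
    intro s hs
    obtain ⟨hL, hd⟩ := aux_deriv f hsum s hs
    have hz : Summable (fun n : ℕ => ((n : ℝ) + 1) ^ (-s)) := by
      have := (summable_nat_add_iff 1).2 (Real.summable_nat_rpow.2 (by linarith : -s < -1))
      simpa using this
    have hb : Tendsto (fun N => ∑ m ∈ Ioc 0 N, Λf m * (m : ℝ) ^ (-s)) atTop
        (𝓝 (D (s - 1) + τ * ∑' n : ℕ, ((n : ℝ) + 1) ^ (-s))) := by
      refine ((hD1 (s - 1) (by linarith)).add (hz.hasSum.tendsto_sum_nat.const_mul τ)).congr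
        fun N => ?_
      have e : Ioc 0 N = Icc 1 N := by ext; simp [Nat.succ_le_iff]
      rw [e, hIcc, mul_sum, ← sum_add_distrib]
      refine sum_congr rfl fun i _ => ?_
      have hp : (0 : ℝ) < (i : ℝ) + 1 := by positivity
      have : ((i : ℝ) + 1) ^ (-(s - 1)) = ((i : ℝ) + 1) * ((i : ℝ) + 1) ^ (-s) := by
        rw [show -(s - 1) = 1 + -s by ring, Real.rpow_add hp, Real.rpow_one]
      rw [this]
      push_cast
      field_simp
      ring
    have hm := aux_mertens (fun n : ℕ => f n * (n : ℝ) ^ (-s)) (fun m : ℕ => Λf m * (m : ℝ) ^ (-s))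
      (fun n : ℕ => f n * Real.log n * (n : ℝ) ^ (-s)) _ (hsum s hs)
      (by simp [Real.zero_rpow (by linarith : -s ≠ 0)]) hb (by
        intro n hn
        rw [hΛf n hn, sum_mul]
        refine sum_congr rfl fun d hd => ?_
        have hdn := (Nat.mem_divisors.1 hd).1
        have : (n : ℝ) ^ (-s) = (d : ℝ) ^ (-s) * ((n / d : ℕ) : ℝ) ^ (-s) := by
          rw [← Real.mul_rpow (by positivity) (by positivity), ← Nat.cast_mul,
            Nat.mul_div_cancel' hdn]
        rw [this]; ring)
    have hd' : Tendsto (fun N => ∑ n ∈ Ioc 0 N, f n * Real.log n * (n : ℝ) ^ (-s)) atTop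
        (𝓝 (-deriv (fun u : ℝ => ∑' n : ℕ, f (n + 1) / ((n : ℝ) + 1) ^ u) s)) := by
      refine (hd.tendsto_sum_nat.comp (tendsto_add_atTop_nat 1)).congr fun N => ?_
      have e : Ioc 0 N = Icc 1 N := by ext; simp [Nat.succ_le_iff]
      rw [e, hIcc]
      simp only [Function.comp]
      rw [sum_range_succ']
      simp
    have heq := tendsto_nhds_unique hd' hm
    rw [← hL s hs] at heq
    have hpos : 0 < ∑' n : ℕ, f (n + 1) / ((n : ℝ) + 1) ^ s := by
      rw [hL s hs]
      have hnn : ∀ n : ℕ, 0 ≤ f n * (n : ℝ) ^ (-s) := by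
        intro n
        rcases Nat.eq_zero_or_pos n with rfl | hn
        · simp [Real.zero_rpow (by linarith : -s ≠ 0)]
        · exact mul_nonneg (aux_nonneg f hf1 hfmult (fun p r hp hr => (hbound p r hp hr).1) n hn)
            (by positivity)
      exact (hsum s hs).tsum_pos hnn 1 (by simp [hf1])
    have h2 : deriv (fun u : ℝ => ∑' n : ℕ, f (n + 1) / ((n : ℝ) + 1) ^ u) s
        / (∑' n : ℕ, f (n + 1) / ((n : ℝ) + 1) ^ s)
        = -(D (s - 1) + τ * ∑' n : ℕ, ((n : ℝ) + 1) ^ (-s)) := by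
      rw [div_eq_iff hpos.ne']
      linarith
    rw [h2]
    ring
  have hshift : Tendsto (fun s : ℝ => s - 1) (𝓝[>] 1) (𝓝[>] 0) := by
    refine tendsto_nhdsWithin_of_tendsto_nhds_of_eventually_within _ ?_ ?_
    · have : Tendsto (fun s : ℝ => s - 1) (𝓝 1) (𝓝 (1 - 1)) := by
        exact (continuous_id.sub continuous_const).tendsto 1
      rw [sub_self] at this
      exact this.mono_left nhdsWithin_le_nhds
    · filter_upwards [self_mem_nhdsWithin] with s hs
      have hs : 1 < s := hs
      exact sub_pos.2 hs
  have hfinal := ((hD2.comp hshift).add (aux_zeta.const_mul τ)).neg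
  rw [sub_add_cancel] at hfinal
  refine hfinal.congr' ?_
  filter_upwards [self_mem_nhdsWithin] with s hs
  exact (key s hs).symm
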